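/- If θ > 1 and ρ > 0, then ln P(X_{θ,ρ} > n) ~ −(ln θ − 1 + 1/θ)·n as n → ∞; i.e., lim_{n→∞} n^{-1} ln P(X_{θ,ρ} > n) = −(ln θ − 1 + 1/θ). -/

import Mathlib

open MeasureTheory ProbabilityTheory

/-- A realization of the two-parameter Yule–Simon model: a counting process `Y`
started from one individual whose jump intensity is the fertility `F`, where
`F(t) = Y(t) − θ∫₀^t F(s)ds` (i.e. each individual of age `a` gives birth at rate
`e^{-θa}`, so `Y` is the general branching process `Y_θ`), together with an
independent exponential time `T` of rate `ρ`. The Yule–Simon variable is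
`X_{θ,ρ} = Y(T)`. -/
structure YuleSimonSetup (θ ρ : ℝ) where
  Ω : Type
  mΩ : MeasurableSpace Ω
  P : Measure Ω
  isProb : IsProbabilityMeasure P
  ℱ : Filtration ℝ mΩ
  Y : ℝ → Ω → ℕ
  F : ℝ → Ω → ℝ
  T : Ω → ℝ
  /-- joint measurability of the process -/
  measY : Measurable fun p : ℝ × Ω => Y p.1 p.2
  measF : Measurable fun p : ℝ × Ω => F p.1 p.2
  /-- the population starts from a single ancestor -/
  Y0 : ∀ ω, Y 0 ω = 1
  /-- paths are non-decreasing on `[0,∞)` -/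
  mono : ∀ ω, MonotoneOn (fun t => Y t ω) (Set.Ici 0)
  /-- paths are right-continuous (piecewise constant) -/
  rightCont : ∀ ω, ∀ t ≥ (0:ℝ), ∃ ε > 0, ∀ s ∈ Set.Ico t (t + ε), Y s ω = Y t ω
  /-- all jumps have unit size: the process passes through every intermediate value -/
  unitJumps : ∀ ω, ∀ t ≥ (0:ℝ), ∀ k : ℕ, 1 ≤ k → k ≤ Y t ω → ∃ s ∈ Set.Icc 0 t, Y s ω = k
  /-- the fertility solves `F(t) = Y(t) − θ∫₀^t F(s)ds` -/
  F_def : ∀ ω, ∀ t ≥ (0:ℝ), F t ω = (Y t ω : ℝ) - θ * ∫ s in (0:ℝ)..t, F s ω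
  adapted : Adapted ℱ fun t ω => (Y t ω : ℝ)
  integrableY : ∀ t, Integrable (fun ω => (Y t ω : ℝ)) P
  integrableF : ∀ t, Integrable (fun ω => ∫ s in (0:ℝ)..t, F s ω) P
  /-- `Y(t) − ∫₀^t F(s)ds` is a martingale: `F` is the intensity of the counting
  process `Y`, which characterizes `Y` as the general branching process `Y_θ`. -/
  martingale : ∀ s t : ℝ, 0 ≤ s → s ≤ t →
    (P[fun ω => (Y t ω : ℝ) - ∫ u in (0:ℝ)..t, F u ω | ℱ s])
      =ᵐ[P] fun ω => (Y s ω : ℝ) - ∫ u in (0:ℝ)..s, F u ω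
  measT : Measurable T
  /-- `T` is exponentially distributed with parameter `ρ` -/
  lawT : ∀ t : ℝ, 0 ≤ t → P {ω | T ω ≤ t} = ENNReal.ofReal (1 - Real.exp (-ρ * t))
  /-- `T` is independent of the branching process -/
  indepT : IndepFun T (fun ω => fun t : ℝ => Y t ω) P

namespace YuleSimonSetup

attribute [instance] YuleSimonSetup.mΩ YuleSimonSetup.isProb

/-- The tail probability `P(X_{θ,ρ} > n)` of the two-parameter Yule–Simon law. -/
noncomputable def tail {θ ρ : ℝ} (S : YuleSimonSetup θ ρ) (n : ℕ) : ENNReal :=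
  S.P {ω | n < S.Y (S.T ω) ω}

end YuleSimonSetup


section YSProof
open Set

structure YSPath (θ : ℝ) (Y : ℝ → ℕ) (F : ℝ → ℝ) : Prop where
  hθ : 0 < θ
  meas : Measurable F
  Y0 : Y 0 = 1
  mono : MonotoneOn Y (Set.Ici 0)
  rc : ∀ t ≥ (0:ℝ), ∃ ε > 0, ∀ s ∈ Set.Ico t (t + ε), Y s = Y t
  uj : ∀ t ≥ (0:ℝ), ∀ k : ℕ, 1 ≤ k → k ≤ Y t → ∃ s ∈ Set.Icc 0 t, Y s = k
  Fd : ∀ t ≥ (0:ℝ), F t = (Y t : ℝ) - θ * ∫ s in (0:ℝ)..t, F s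

namespace YSPath
variable {θ : ℝ} {Y : ℝ → ℕ} {F : ℝ → ℝ}

/-- comparison bounds on an interval where `F` is integrable -/
theorem bounds (h : YSPath θ Y F) {s t : ℝ} (hs : 0 ≤ s) (hst : s ≤ t)
    (hint : IntervalIntegrable F volume 0 t) :
    F s * (1 - Real.exp (-(θ * (t - s)))) / θ ≤ (∫ u in (0:ℝ)..t, F u) - ∫ u in (0:ℝ)..s, F u ∧
    (∫ u in (0:ℝ)..t, F u) - (∫ u in (0:ℝ)..s, F u) ≤
      (F s + Y t - Y s) * (1 - Real.exp (-(θ * (t - s)))) / θ := by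
  have hθ := h.hθ
  set I : ℝ → ℝ := fun r => ∫ u in (0:ℝ)..r, F u with hI
  have ht : 0 ≤ t := hs.trans hst
  have hIc : ContinuousOn I (Icc 0 t) := by
    have := intervalIntegral.continuousOn_primitive_interval (μ := volume) (f := F) (a := 0) (b := t)
      (by rw [uIcc_of_le ht]; exact (intervalIntegrable_iff_integrableOn_Icc_of_le ht).1 hint)
    rwa [uIcc_of_le ht] at this
  have hder : ∀ r ∈ Ico s t, HasDerivWithinAt I (F r) (Ici r) r := by
    intro r hr
    have hr0 : 0 ≤ r := hs.trans hr.1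
    have hi : IntervalIntegrable F volume 0 r :=
      hint.mono_set (by rw [uIcc_of_le hr0, uIcc_of_le ht]; exact Icc_subset_Icc_right hr.2.le)
    refine intervalIntegral.integral_hasDerivWithinAt_right hi
      (h.meas.stronglyMeasurable.stronglyMeasurableAtFilter) ?_
    obtain ⟨ε, hε, hY⟩ := h.rc r hr0
    have hc : ContinuousWithinAt (fun x => (Y r : ℝ) - θ * I x) (Ici r) r := by
      have : ContinuousWithinAt I (Ici r) r := by
        have h1 := hIc r ⟨hr0, hr.2.le⟩
        refine h1.mono_of_mem_nhdsWithin ?_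
        filter_upwards [self_mem_nhdsWithin, mem_nhdsWithin_of_mem_nhds (Iio_mem_nhds hr.2)] with x hx hx2
        exact ⟨hr0.trans hx, le_of_lt hx2⟩
      exact continuousWithinAt_const.sub (continuousWithinAt_const.mul this)
    refine (hc.congr_of_eventuallyEq ?_ ?_).mono Ioi_subset_Ici_self
    · filter_upwards [self_mem_nhdsWithin, mem_nhdsWithin_of_mem_nhds (Iio_mem_nhds (show r < r + ε by linarith))] with x hx hx2
      rw [h.Fd x (hr0.trans hx), hY x ⟨hx, hx2⟩]
    · exact h.Fd r hr0
  -- weighted increments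
  set D : ℝ → ℝ := fun r => Real.exp (θ * r) * (I r - I s) with hD
  have hDder : ∀ r ∈ Ico s t, HasDerivWithinAt D (Real.exp (θ * r) * (F s + Y r - Y s)) (Ici r) r := by
    intro r hr
    have h1 : HasDerivAt (fun r => Real.exp (θ * r)) (Real.exp (θ * r) * θ) r := by
      simpa using ((hasDerivAt_id r).const_mul θ).exp
    have h2 := h1.hasDerivWithinAt.mul ((hder r hr).sub_const (I s)) (s := Ici r)
    refine h2.congr_deriv ?_
    have e1 := h.Fd r (hs.trans hr.1)
    have e2 := h.Fd s hs
    change F r = Y r - θ * I r at e1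
    change F s = Y s - θ * I s at e2
    rw [e1, e2]; ring
  have hDc : ContinuousOn D (Icc s t) := by
    refine ContinuousOn.mul (by fun_prop) ?_
    exact (hIc.mono (Icc_subset_Icc_left hs)).sub continuousOn_const
  have hB : ∀ A : ℝ, ∀ r, HasDerivAt (fun r => A * (Real.exp (θ * r) - Real.exp (θ * s)) / θ) (Real.exp (θ * r) * A) r := by
    intro A r
    have h1 : HasDerivAt (fun r => Real.exp (θ * r)) (Real.exp (θ * r) * θ) r := by
      simpa using ((hasDerivAt_id r).const_mul θ).exp
    refine (((h1.sub_const (Real.exp (θ * s))).const_mul A).div_const θ).congr_deriv ?_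
    field_simp
  have hD0 : D s = 0 := by simp [hD]
  have hexp : Real.exp (-(θ * (t - s))) = Real.exp (θ * s) / Real.exp (θ * t) := by
    rw [← Real.exp_sub]; congr 1; ring
  have hpos := Real.exp_pos (θ * t)
  have up := image_le_of_deriv_right_le_deriv_boundary (f := D) hDc hDder
    (B := fun r => (F s + Y t - Y s) * (Real.exp (θ * r) - Real.exp (θ * s)) / θ)
    (B' := fun r => Real.exp (θ * r) * (F s + Y t - Y s)) (by simp [hD0])
    (fun r _ => ((hB _ r).continuousAt.continuousWithinAt)) (fun r _ => (hB _ r).hasDerivWithinAt) (by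
      intro r hr
      have : (Y r : ℝ) ≤ Y t := by exact_mod_cast h.mono (hs.trans hr.1) ht hr.2.le
      gcongr) (right_mem_Icc.2 hst)
  have lo := image_le_of_deriv_right_le_deriv_boundary (f := fun r => -D r) hDc.neg (fun r hr => (hDder r hr).neg)
    (B := fun r => (- F s) * (Real.exp (θ * r) - Real.exp (θ * s)) / θ)
    (B' := fun r => Real.exp (θ * r) * (-F s)) (by simp [hD0])
    (fun r _ => ((hB _ r).continuousAt.continuousWithinAt)) (fun r _ => (hB _ r).hasDerivWithinAt) (by
      intro r hr
      have : (Y s : ℝ) ≤ Y r := by exact_mod_cast h.mono hs (hs.trans hr.1) hr.1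
      rw [← mul_neg]
      gcongr
      linarith) (right_mem_Icc.2 hst)
  simp only [hD] at up lo
  change F s * (1 - Real.exp (-(θ * (t - s)))) / θ ≤ I t - I s ∧ I t - I s ≤ _
  rw [hexp]
  constructor
  · rw [show F s * (1 - Real.exp (θ * s) / Real.exp (θ * t)) / θ
      = (F s * (Real.exp (θ * t) - Real.exp (θ * s)) / θ) / Real.exp (θ * t) by field_simp]
    rw [div_le_iff₀ hpos]
    have : -F s * (Real.exp (θ * t) - Real.exp (θ * s)) / θ = -(F s * (Real.exp (θ * t) - Real.exp (θ * s)) / θ) := by ring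
    linarith
  · rw [show (F s + Y t - Y s) * (1 - Real.exp (θ * s) / Real.exp (θ * t)) / θ
      = ((F s + Y t - Y s) * (Real.exp (θ * t) - Real.exp (θ * s)) / θ) / Real.exp (θ * t) by field_simp]
    rw [le_div_iff₀ hpos]
    linarith

theorem F0 (h : YSPath θ Y F) : F 0 = 1 := by
  rw [h.Fd 0 le_rfl, h.Y0]; simp

theorem F_bounds (h : YSPath θ Y F) {t : ℝ} (ht : 0 ≤ t) : 0 ≤ F t ∧ F t ≤ Y t := by
  have hθ := h.hθ
  by_cases hint : IntervalIntegrable F volume 0 t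
  · have hb := h.bounds le_rfl ht hint
    rw [h.F0, h.Y0] at hb
    simp only [intervalIntegral.integral_same, sub_zero, Nat.cast_one, add_sub_cancel_left] at hb
    have hF := h.Fd t ht
    have he : Real.exp (-(θ * t)) ≤ 1 := Real.exp_le_one_iff.2 (by nlinarith)
    have he0 := Real.exp_pos (-(θ * t))
    have hY : (0:ℝ) ≤ Y t := by positivity
    obtain ⟨h1, h2⟩ := hb
    rw [div_le_iff₀ hθ] at h1
    rw [le_div_iff₀ hθ] at h2
    constructor
    · nlinarith
    · nlinarith
  · have := h.Fd t ht
    rw [intervalIntegral.integral_undef hint] at this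
    rw [this]; simp

theorem integrable (h : YSPath θ Y F) {t : ℝ} (ht : 0 ≤ t) : IntervalIntegrable F volume 0 t := by
  rw [intervalIntegrable_iff_integrableOn_Icc_of_le ht]
  refine Measure.integrableOn_of_bounded (M := (Y t : ℝ)) (by simp) h.meas.aestronglyMeasurable ?_
  rw [ae_restrict_iff' measurableSet_Icc]
  refine Filter.Eventually.of_forall fun s hs => ?_
  obtain ⟨h1, h2⟩ := h.F_bounds hs.1
  rw [Real.norm_of_nonneg h1]
  refine h2.trans ?_
  exact_mod_cast h.mono hs.1 ht hs.2

theorem dI_lower (h : YSPath θ Y F) {s t : ℝ} (hs : 0 ≤ s) (hst : s ≤ t) :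
    F s * ((1 - Real.exp (-(θ * (t - s)))) / θ) ≤ (∫ u in (0:ℝ)..t, F u) - ∫ u in (0:ℝ)..s, F u := by
  rw [← mul_div_assoc]
  exact (h.bounds hs hst (h.integrable (hs.trans hst))).1

theorem dI_nonneg (h : YSPath θ Y F) {s t : ℝ} (hs : 0 ≤ s) (hst : s ≤ t) :
    0 ≤ (∫ u in (0:ℝ)..t, F u) - ∫ u in (0:ℝ)..s, F u := by
  refine le_trans ?_ (h.dI_lower hs hst)
  refine mul_nonneg (h.F_bounds hs).1 (div_nonneg ?_ h.hθ.le)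
  have : Real.exp (-(θ * (t - s))) ≤ 1 := Real.exp_le_one_iff.2 (by nlinarith [h.hθ])
  linarith

theorem dI_upper (h : YSPath θ Y F) {s t : ℝ} (hs : 0 ≤ s) (hst : s ≤ t) :
    (∫ u in (0:ℝ)..t, F u) - ∫ u in (0:ℝ)..s, F u ≤ Y t * (t - s) := by
  refine (h.bounds hs hst (h.integrable (hs.trans hst))).2.trans ?_
  have hθ := h.hθ
  rw [mul_div_assoc]
  have h1 : (1 - Real.exp (-(θ * (t - s)))) / θ ≤ t - s := by
    rw [div_le_iff₀ hθ]
    have := Real.add_one_le_exp (-(θ * (t - s)))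
    linarith
  have h2 := (h.F_bounds hs).2
  have h3 : 0 ≤ (1 - Real.exp (-(θ * (t - s)))) / θ := by
    refine div_nonneg ?_ hθ.le
    have : Real.exp (-(θ * (t - s))) ≤ 1 := Real.exp_le_one_iff.2 (by nlinarith)
    linarith
  have h4 : (0:ℝ) ≤ Y t := by positivity
  calc _ ≤ (Y t : ℝ) * ((1 - Real.exp (-(θ * (t - s)))) / θ) := by gcongr; linarith
    _ ≤ _ := by gcongr

theorem gap (h : YSPath θ Y F) (m : ℕ) (hm : 1 ≤ m) :
    ∃ ε > 0, ∀ r s : ℝ, 0 ≤ r → r ≤ s → Y r < m → m < Y s → ε ≤ s - r := by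
  by_cases hne : ∃ s, 0 ≤ s ∧ m ≤ Y s
  swap
  · push Not at hne
    refine ⟨1, one_pos, fun r s hr hrs _ h2 => ?_⟩
    have := hne s (hr.trans hrs)
    omega
  set A : Set ℝ := {s | 0 ≤ s ∧ m ≤ Y s} with hA
  have hbdd : BddBelow A := ⟨0, fun x hx => hx.1⟩
  have hneA : A.Nonempty := hne
  set τ := sInf A with hτ
  have hτ0 : 0 ≤ τ := le_csInf hneA fun x hx => hx.1
  obtain ⟨ε, hε, hY⟩ := h.rc τ hτ0
  have hYτ1 : m ≤ Y τ := by
    obtain ⟨x, hx, hx2⟩ := exists_lt_of_csInf_lt hneA (show sInf A < τ + ε by linarith)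
    rw [← hY x ⟨csInf_le hbdd hx, hx2⟩]; exact hx.2
  have hYτ2 : Y τ ≤ m := by
    obtain ⟨s0, hs0, hs1⟩ := h.uj τ hτ0 m hm hYτ1
    have h1 : τ ≤ s0 := csInf_le hbdd ⟨hs0.1, hs1.ge⟩
    rw [← hs1]
    exact h.mono hτ0 hs0.1 h1
  refine ⟨ε, hε, fun r s hr hrs h1 h2 => ?_⟩
  have hrτ : r < τ := by
    by_contra hc
    have := h.mono hτ0 hr (not_lt.1 hc)
    omega
  have hsτ : τ + ε ≤ s := by
    by_contra hc
    rcases le_total s τ with h3 | h3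
    · have := h.mono (hr.trans hrs) hτ0 h3
      omega
    · have := hY s ⟨h3, not_le.1 hc⟩
      omega
  linarith

/-- for fine enough meshes on `[0,t]`, no two jumps fall in one interval -/
theorem mesh (h : YSPath θ Y F) {t : ℝ} (ht : 0 ≤ t) :
    ∃ ε > 0, ∀ r s : ℝ, 0 ≤ r → r ≤ s → s ≤ t → s - r < ε → Y s ≤ Y r + 1 := by
  choose! g hg hg2 using fun m => h.gap m
  obtain ⟨ε, hε, hε2⟩ : ∃ ε > 0, ∀ m ∈ Finset.Icc 1 (Y t), ε ≤ g m := by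
    refine ⟨(insert 1 ((Finset.Icc 1 (Y t)).image g)).min' (by simp), ?_, ?_⟩
    · rw [gt_iff_lt, Finset.lt_min'_iff]
      intro y hy
      simp only [Finset.mem_insert, Finset.mem_image, Finset.mem_Icc] at hy
      rcases hy with rfl | ⟨m, hm, rfl⟩
      · exact one_pos
      · exact hg m hm.1
    · intro m hm
      exact Finset.min'_le _ _ (by simp only [Finset.mem_insert, Finset.mem_image]; exact Or.inr ⟨m, hm, rfl⟩)
  refine ⟨ε, hε, fun r s hr hrs hst hlt => ?_⟩
  by_contra hc
  have h1 : Y s ≤ Y t := h.mono (hr.trans hrs) ht hst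
  have h2 := hg2 (Y r + 1) (by omega) r s hr hrs (by omega) (by omega)
  have h3 := hε2 (Y r + 1) (by simp; omega)
  linarith

end YSPath

end YSProof

/-- test functions `f y x` with derivative `f' y x` in `x`, controlled for `0 ≤ x ≤ y` -/
structure GoodTest (f f' : ℕ → ℝ → ℝ) (K : ℝ) : Prop where
  Kpos : 0 ≤ K
  meas : ∀ y, Measurable (f y)
  meas' : ∀ y, Measurable (f' y)
  bdd : ∀ (y : ℕ) (x : ℝ), 0 ≤ x → x ≤ y → |f y x| ≤ K
  bdd' : ∀ (y : ℕ) (x : ℝ), 0 ≤ x → x ≤ y → |f' y x| ≤ K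
  lip : ∀ (y : ℕ) (x x' : ℝ), 0 ≤ x → x ≤ y → 0 ≤ x' → x' ≤ y → |f y x' - f y x| ≤ K * |x' - x|
  quad : ∀ (y : ℕ) (x x' : ℝ), 0 ≤ x → x ≤ y → 0 ≤ x' → x' ≤ y →
    |f y x' - f y x - f' y x * (x' - x)| ≤ K * (x' - x) ^ 2

theorem GoodTest.err_bound {f f' : ℕ → ℝ → ℝ} {K : ℝ} (G : GoodTest f f' K) {θ : ℝ} (hθ : 0 < θ)
    {y y' : ℕ} {x x' d : ℝ} (hy : y ≤ y') (hx : 0 ≤ x) (hxy : x ≤ y) (hx' : 0 ≤ x') (hxy' : x' ≤ y')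
    (hd : 0 ≤ d) (he : x' = x + ((y' : ℝ) - y) - θ * d) :
    |f y' x' - f y x - (f (y + 1) (x + 1) - f y x) * ((y' : ℝ) - y) + θ * f' y x * d|
      ≤ K * (θ ^ 2 + 2 * θ + 4) * (d + ((y' : ℝ) - y)) ∧
    (y' ≤ y + 1 →
    |f y' x' - f y x - (f (y + 1) (x + 1) - f y x) * ((y' : ℝ) - y) + θ * f' y x * d|
      ≤ K * (θ ^ 2 + 2 * θ + 4) * (d * (d + ((y' : ℝ) - y)))) := by
  have hK := G.Kpos
  have b' := G.bdd' y x hx hxy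
  have hb' : |θ * f' y x * d| ≤ K * θ * d := by
    rw [abs_mul, abs_mul, abs_of_pos hθ, abs_of_nonneg hd]
    calc θ * |f' y x| * d ≤ θ * K * d := by gcongr
      _ = _ := by ring
  have hKd : 0 ≤ K * d := by positivity
  have hKθd : 0 ≤ K * θ * d := by positivity
  have hKθd2 : 0 ≤ K * θ ^ 2 * d := by positivity
  rcases hy.eq_or_lt with rfl | hlt
  · simp only [sub_self, add_zero, mul_zero, sub_zero] at *
    have hxx : x' - x = -(θ * d) := by rw [he]; ring
    have h1 := G.lip y x x' hx hxy hx' hxy'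
    rw [hxx, abs_neg, abs_of_nonneg (mul_nonneg hθ.le hd)] at h1
    have h2 := G.quad y x x' hx hxy hx' hxy'
    rw [hxx] at h2
    constructor
    · calc _ ≤ |f y x' - f y x| + |θ * f' y x * d| := abs_add_le _ _
        _ ≤ K * (θ * d) + K * θ * d := add_le_add h1 hb'
        _ ≤ _ := by nlinarith
    · intro _
      have : f y x' - f y x + θ * f' y x * d = f y x' - f y x - f' y x * -(θ * d) := by ring
      rw [this]
      refine h2.trans ?_
      have : 0 ≤ K * d ^ 2 := by positivity
      have : 0 ≤ K * θ * d ^ 2 := by positivity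
      nlinarith
  · have hge : (1 : ℝ) ≤ (y' : ℝ) - y := by
      have : ((y : ℝ) + 1) ≤ y' := by exact_mod_cast hlt
      linarith
    have c1 : |f (y + 1) (x + 1)| ≤ K := G.bdd _ _ (by linarith) (by push_cast; linarith)
    have c2 := G.bdd y x hx hxy
    have c3 := G.bdd y' x' hx' hxy'
    set δ : ℝ := (y' : ℝ) - y with hδ
    constructor
    · have c4 : |(f (y + 1) (x + 1) - f y x) * δ| ≤ (K + K) * δ := by
        rw [abs_mul, abs_of_nonneg (by linarith : 0 ≤ δ)]
        gcongr
        exact (abs_sub _ _).trans (add_le_add c1 c2)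
      calc _ ≤ |f y' x' - f y x - (f (y + 1) (x + 1) - f y x) * δ| + |θ * f' y x * d| := abs_add_le _ _
        _ ≤ |f y' x' - f y x| + |(f (y + 1) (x + 1) - f y x) * δ| + |θ * f' y x * d| := by
            gcongr; exact abs_sub _ _
        _ ≤ (|f y' x'| + |f y x|) + (K + K) * δ + K * θ * d := by
            gcongr; exact abs_sub _ _
        _ ≤ (K + K) + (K + K) * δ + K * θ * d := by gcongr
        _ ≤ _ := by
          have : 0 ≤ K * (δ - 1) := mul_nonneg hK (by linarith)
          have : 0 ≤ K * θ * δ := by positivity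
          have : 0 ≤ K * θ ^ 2 * δ := by positivity
          nlinarith
    · intro h1
      have hyy : y' = y + 1 := by omega
      have hδ1 : δ = 1 := by rw [hδ, hyy]; push_cast; ring
      clear_value δ
      subst hδ1
      subst hyy
      have hl := G.lip (y + 1) (x + 1) x' (by linarith) (by push_cast; linarith) hx' hxy'
      have hxx : x' - (x + 1) = -(θ * d) := by rw [he]; ring
      rw [hxx, abs_neg, abs_of_nonneg (mul_nonneg hθ.le hd)] at hl
      calc _ = |(f (y + 1) x' - f (y + 1) (x + 1)) + θ * f' y x * d| := by congr 1; ring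
        _ ≤ K * (θ * d) + K * θ * d := (abs_add_le _ _).trans (add_le_add hl hb')
        _ ≤ _ := by
          have : 0 ≤ K * d ^ 2 := by positivity
          have : 0 ≤ K * θ * d ^ 2 := by positivity
          have : 0 ≤ K * θ ^ 2 * d ^ 2 := by positivity
          nlinarith

namespace YuleSimonSetup
variable {θ ρ : ℝ} (S : YuleSimonSetup θ ρ)

noncomputable def cumI (t : ℝ) (ω : S.Ω) : ℝ := ∫ u in (0:ℝ)..t, S.F u ω

theorem path (hθ : 0 < θ) (ω : S.Ω) : YSPath θ (fun t => S.Y t ω) (fun t => S.F t ω) where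
  hθ := hθ
  meas := S.measF.comp (measurable_id.prodMk measurable_const)
  Y0 := S.Y0 ω
  mono := S.mono ω
  rc := S.rightCont ω
  uj := S.unitJumps ω
  Fd := S.F_def ω

theorem measYt (t : ℝ) : Measurable (S.Y t) := S.measY.comp (measurable_const.prodMk measurable_id)
theorem measFt (t : ℝ) : Measurable (S.F t) := S.measF.comp (measurable_const.prodMk measurable_id)

theorem meas_comp {g : ℕ → ℝ → ℝ} (hg : ∀ y, Measurable (g y)) (t : ℝ) :
    Measurable fun ω => g (S.Y t ω) (S.F t ω) := by
  have : Measurable fun p : ℝ × ℕ => g p.2 p.1 := measurable_from_prod_countable_left hg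
  exact this.comp ((S.measFt t).prodMk (S.measYt t))

theorem integrable_cumI (t : ℝ) : Integrable (S.cumI t) S.P := S.integrableF t

/-- orthogonality of martingale increments -/
theorem orth {g : ℕ → ℝ → ℝ} (hg : ∀ y, Measurable (g y)) {B : ℝ}
    {s t : ℝ} (hs : 0 ≤ s) (hst : s ≤ t) (hB : ∀ ω, |g (S.Y s ω) (S.F s ω)| ≤ B) :
    ∫ ω, g (S.Y s ω) (S.F s ω) * ((S.Y t ω : ℝ) - S.Y s ω) ∂S.P
      = ∫ ω, g (S.Y s ω) (S.F s ω) * (S.cumI t ω - S.cumI s ω) ∂S.P := by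
  set H : S.Ω → ℝ := fun ω => g (S.Y s ω) (S.F s ω) with hH
  have hHm : Measurable H := S.meas_comp hg s
  set M : ℝ → S.Ω → ℝ := fun t ω => (S.Y t ω : ℝ) - S.cumI t ω with hM
  have hMi : ∀ t, Integrable (M t) S.P := fun t => (S.integrableY t).sub (S.integrable_cumI t)
  have hmart : S.P[M t | S.ℱ s] =ᵐ[S.P] M s := S.martingale s t hs hst
  have hmul : ∀ {X : S.Ω → ℝ}, Integrable X S.P → Integrable (fun ω => H ω * X ω) S.P := fun hX =>
    hX.bdd_mul hHm.aestronglyMeasurable (Filter.Eventually.of_forall hB)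
  have hYm : Measurable[S.ℱ s] (S.Y s) := by
    have h1 := S.adapted s
    have : S.Y s = fun ω => Nat.floor ((S.Y s ω : ℝ)) := by ext ω; simp
    rw [this]
    exact Nat.measurable_floor.comp h1
  have hHae : AEStronglyMeasurable[S.ℱ s] H S.P := by
    set J : S.Ω → ℝ := fun ω => (S.Y s ω : ℝ) - (S.P[M t | S.ℱ s]) ω with hJ
    have hJm : Measurable[S.ℱ s] J :=
      (S.adapted s).sub stronglyMeasurable_condExp.measurable
    have hg2 : Measurable fun p : ℝ × ℕ => g p.2 p.1 := measurable_from_prod_countable_left hg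
    refine ⟨fun ω => g (S.Y s ω) (S.Y s ω - θ * J ω), ?_, ?_⟩
    · have h3 : Measurable[S.ℱ s] fun ω => ((S.Y s ω : ℝ) - θ * J ω, S.Y s ω) :=
        ((S.adapted s).sub (hJm.const_mul θ)).prodMk hYm
      exact (hg2.comp h3).stronglyMeasurable
    · filter_upwards [hmart] with ω hω
      have : J ω = S.cumI s ω := by
        simp only [hJ]; rw [hω]; simp only [hM]; ring
      simp only [hH]
      rw [this, S.F_def ω s hs]; rfl
  have hce := condExp_mul_of_aestronglyMeasurable_left hHae (hmul (hMi t)) (hMi t)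
  have e1 : ∫ ω, H ω * M t ω ∂S.P = ∫ ω, H ω * M s ω ∂S.P := by
    have := integral_condExp (μ := S.P) (S.ℱ.le s) (f := H * M t)
    rw [show (∫ ω, H ω * M t ω ∂S.P) = ∫ ω, (H * M t) ω ∂S.P from rfl, ← this]
    refine integral_congr_ae ?_
    filter_upwards [hce, hmart] with ω h1 h2
    rw [h1, Pi.mul_apply, h2]
  have hi1 : Integrable (fun ω => H ω * ((S.Y t ω : ℝ) - S.Y s ω)) S.P :=
    hmul ((S.integrableY t).sub (S.integrableY s))
  have hi2 : Integrable (fun ω => H ω * (S.cumI t ω - S.cumI s ω)) S.P :=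
    hmul ((S.integrable_cumI t).sub (S.integrable_cumI s))
  rw [← sub_eq_zero, ← integral_sub hi1 hi2]
  rw [← sub_eq_zero, ← integral_sub (hmul (hMi t)) (hmul (hMi s))] at e1
  rw [← e1]
  congr 1; ext ω; simp only [hM]; ring

/-- one-step error -/
noncomputable def stepErr (f f' : ℕ → ℝ → ℝ) (s t : ℝ) (ω : S.Ω) : ℝ :=
  f (S.Y t ω) (S.F t ω) - f (S.Y s ω) (S.F s ω)
    - (f (S.Y s ω + 1) (S.F s ω + 1) - f (S.Y s ω) (S.F s ω)) * ((S.Y t ω : ℝ) - S.Y s ω)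
    + θ * f' (S.Y s ω) (S.F s ω) * (S.cumI t ω - S.cumI s ω)

/-- generator divided by `x` -/
def gen (θ : ℝ) (f f' : ℕ → ℝ → ℝ) (y : ℕ) (x : ℝ) : ℝ :=
  f (y + 1) (x + 1) - f y x - θ * f' y x

section
variable {f f' : ℕ → ℝ → ℝ} {K : ℝ}

theorem int_f (hθ : 0 < θ) (G : GoodTest f f' K) {t : ℝ} (ht : 0 ≤ t) :
    Integrable (fun ω => f (S.Y t ω) (S.F t ω)) S.P := by
  refine Integrable.of_bound (S.meas_comp G.meas t).aestronglyMeasurable K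
    (Filter.Eventually.of_forall fun ω => ?_)
  have := (S.path hθ ω).F_bounds ht
  exact G.bdd _ _ this.1 this.2

theorem meas_shift (G : GoodTest f f' K) (y : ℕ) : Measurable fun x => f (y + 1) (x + 1) - f y x :=
  ((G.meas (y + 1)).comp (measurable_id.add_const 1)).sub (G.meas y)

theorem shift_bdd (hθ : 0 < θ) (G : GoodTest f f' K) {t : ℝ} (ht : 0 ≤ t) (ω : S.Ω) :
    |f (S.Y t ω + 1) (S.F t ω + 1) - f (S.Y t ω) (S.F t ω)| ≤ K + K := by
  have h := (S.path hθ ω).F_bounds ht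
  refine (abs_sub _ _).trans (add_le_add (G.bdd _ _ (by linarith [h.1]) ?_) (G.bdd _ _ h.1 h.2))
  push_cast; linarith [h.2]

theorem int_gen (hθ : 0 < θ) (G : GoodTest f f' K) {s t : ℝ} (hs : 0 ≤ s) :
    Integrable (fun ω => gen θ f f' (S.Y s ω) (S.F s ω) * (S.cumI t ω - S.cumI s ω)) S.P := by
  refine ((S.integrable_cumI t).sub (S.integrable_cumI s)).bdd_mul (c := K + K + θ * K)
    (S.meas_comp (g := gen θ f f') (fun y => (meas_shift G y).sub ((G.meas' y).const_mul θ)) s).aestronglyMeasurable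
    (Filter.Eventually.of_forall fun ω => ?_)
  have h := (S.path hθ ω).F_bounds hs
  refine (abs_sub _ _).trans (add_le_add (S.shift_bdd hθ G hs ω) ?_)
  rw [abs_mul, abs_of_pos hθ]
  gcongr
  exact G.bdd' _ _ h.1 h.2

theorem int_stepErr (hθ : 0 < θ) (G : GoodTest f f' K) {s t : ℝ} (hs : 0 ≤ s) (hst : s ≤ t) :
    Integrable (S.stepErr f f' s t) S.P ∧
    ∫ ω, S.stepErr f f' s t ω ∂S.P = (∫ ω, f (S.Y t ω) (S.F t ω) ∂S.P) - (∫ ω, f (S.Y s ω) (S.F s ω) ∂S.P)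
      - ∫ ω, gen θ f f' (S.Y s ω) (S.F s ω) * (S.cumI t ω - S.cumI s ω) ∂S.P := by
  have i1 := S.int_f hθ G (hs.trans hst)
  have i2 := S.int_f hθ G hs
  have hm := S.meas_comp (g := fun y x => f (y + 1) (x + 1) - f y x) (meas_shift G) s
  have i3 : Integrable (fun ω => (f (S.Y s ω + 1) (S.F s ω + 1) - f (S.Y s ω) (S.F s ω)) * ((S.Y t ω : ℝ) - S.Y s ω)) S.P :=
    ((S.integrableY t).sub (S.integrableY s)).bdd_mul hm.aestronglyMeasurable
      (Filter.Eventually.of_forall fun ω => S.shift_bdd hθ G hs ω)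
  have i3' : Integrable (fun ω => (f (S.Y s ω + 1) (S.F s ω + 1) - f (S.Y s ω) (S.F s ω)) * (S.cumI t ω - S.cumI s ω)) S.P :=
    ((S.integrable_cumI t).sub (S.integrable_cumI s)).bdd_mul hm.aestronglyMeasurable
      (Filter.Eventually.of_forall fun ω => S.shift_bdd hθ G hs ω)
  have i4 := S.int_gen hθ G hs (t := t)
  have ho := S.orth (g := fun y x => f (y + 1) (x + 1) - f y x) (meas_shift G) hs hst (S.shift_bdd hθ G hs)
  have heq : S.stepErr f f' s t = fun ω => (f (S.Y t ω) (S.F t ω) - f (S.Y s ω) (S.F s ω))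
      - (f (S.Y s ω + 1) (S.F s ω + 1) - f (S.Y s ω) (S.F s ω)) * ((S.Y t ω : ℝ) - S.Y s ω)
      + ((f (S.Y s ω + 1) (S.F s ω + 1) - f (S.Y s ω) (S.F s ω)) * (S.cumI t ω - S.cumI s ω)
        - gen θ f f' (S.Y s ω) (S.F s ω) * (S.cumI t ω - S.cumI s ω)) := by
    ext ω; simp only [stepErr, gen]; ring
  rw [heq]
  refine ⟨((i1.sub i2).sub i3).add (i3'.sub i4), ?_⟩
  have q1 := integral_add ((i1.sub i2).sub i3) (i3'.sub i4)
  have q2 := integral_sub (i1.sub i2) i3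
  have q3 := integral_sub i1 i2
  have q4 := integral_sub i3' i4
  simp only [Pi.sub_apply] at q1 q2 q3 q4
  refine q1.trans ?_
  rw [q2, q3, q4]
  rw [ho]; ring

theorem core (hθ : 0 < θ) (G : GoodTest f f' K) {t : ℝ} (ht : 0 < t) :
    Filter.Tendsto (fun k : ℕ => ∑ i ∈ Finset.range k,
      |(∫ ω, f (S.Y (t * (i + 1 : ℕ) / k) ω) (S.F (t * (i + 1 : ℕ) / k) ω) ∂S.P)
        - (∫ ω, f (S.Y (t * i / k) ω) (S.F (t * i / k) ω) ∂S.P)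
        - ∫ ω, gen θ f f' (S.Y (t * i / k) ω) (S.F (t * i / k) ω) *
          (S.cumI (t * (i + 1 : ℕ) / k) ω - S.cumI (t * i / k) ω) ∂S.P|) Filter.atTop (nhds 0) := by
  set p : ℕ → ℕ → ℝ := fun k i => t * i / k with hp
  have hp0 : ∀ k i, 0 ≤ p k i := fun k i => by simp only [hp]; positivity
  have hpm : ∀ k i, p k i ≤ p k (i + 1) := fun k i => by
    simp only [hp]; gcongr; simp
  have hpt : ∀ k i, i < k → p k (i + 1) ≤ t := fun k i hik => by
    have hk : (0:ℝ) < k := by exact_mod_cast (by omega : 0 < k)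
    simp only [hp]
    rw [div_le_iff₀ hk]
    gcongr
    exact_mod_cast hik
  have hpd : ∀ k i, p k (i + 1) - p k i = t / k := fun k i => by
    simp only [hp]; push_cast; ring
  set L := K * (θ ^ 2 + 2 * θ + 4) with hL
  have hL0 : 0 ≤ L := by have := G.Kpos; positivity
  have key : ∀ k i, i < k → ∀ ω,
      |S.stepErr f f' (p k i) (p k (i+1)) ω| ≤ L * ((S.cumI (p k (i+1)) ω - S.cumI (p k i) ω) + ((S.Y (p k (i+1)) ω : ℝ) - S.Y (p k i) ω)) ∧
      (S.Y (p k (i+1)) ω ≤ S.Y (p k i) ω + 1 →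
       |S.stepErr f f' (p k i) (p k (i+1)) ω| ≤ L * ((S.cumI (p k (i+1)) ω - S.cumI (p k i) ω) * ((S.cumI (p k (i+1)) ω - S.cumI (p k i) ω) + ((S.Y (p k (i+1)) ω : ℝ) - S.Y (p k i) ω)))) := by
    intro k i hik ω
    have P := S.path hθ ω
    have b1 := P.F_bounds (hp0 k i)
    have b2 := P.F_bounds (hp0 k (i+1))
    refine G.err_bound hθ (S.mono ω (hp0 k i) (hp0 k (i+1)) (hpm k i)) b1.1 b1.2 b2.1 b2.2
      (P.dI_nonneg (hp0 k i) (hpm k i)) ?_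
    rw [S.F_def ω _ (hp0 k i), S.F_def ω _ (hp0 k (i+1))]
    simp only [cumI]; ring
  have tele : ∀ k ω, 0 < k → ∑ i ∈ Finset.range k, ((S.cumI (p k (i+1)) ω - S.cumI (p k i) ω) + ((S.Y (p k (i+1)) ω : ℝ) - S.Y (p k i) ω)) ≤ S.cumI t ω + S.Y t ω := by
    intro k ω hk
    rw [Finset.sum_add_distrib, Finset.sum_range_sub (fun i => S.cumI (p k i) ω), Finset.sum_range_sub (fun i => (S.Y (p k i) ω : ℝ))]
    have hk' : (k:ℝ) ≠ 0 := by exact_mod_cast hk.ne'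
    have e1 : p k k = t := by simp only [hp]; field_simp
    have e2 : p k 0 = 0 := by simp [hp]
    rw [e1, e2, S.Y0]
    have : S.cumI 0 ω = 0 := by simp [cumI]
    rw [this]; push_cast; linarith
  have hlim : Filter.Tendsto (fun k : ℕ => ∫ ω, ∑ i ∈ Finset.range k, |S.stepErr f f' (p k i) (p k (i+1)) ω| ∂S.P)
      Filter.atTop (nhds (∫ ω, (0:ℝ) ∂S.P)) := by
    refine tendsto_integral_filter_of_dominated_convergence (fun ω => L * (S.cumI t ω + S.Y t ω)) ?_ ?_ ?_ ?_
    · refine Filter.Eventually.of_forall fun k => ?_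
      exact (integrable_finsetSum _ fun i _ => (S.int_stepErr hθ G (hp0 k i) (hpm k i)).1.abs).aestronglyMeasurable
    · filter_upwards [Filter.eventually_gt_atTop 0] with k hk
      refine Filter.Eventually.of_forall fun ω => ?_
      rw [Real.norm_of_nonneg (Finset.sum_nonneg fun i _ => abs_nonneg _)]
      calc _ ≤ ∑ i ∈ Finset.range k, L * ((S.cumI (p k (i+1)) ω - S.cumI (p k i) ω) + ((S.Y (p k (i+1)) ω : ℝ) - S.Y (p k i) ω)) :=
            Finset.sum_le_sum fun i hi => (key k i (Finset.mem_range.1 hi) ω).1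
        _ ≤ _ := by rw [← Finset.mul_sum]; gcongr; exact tele k ω hk
    · exact ((S.integrable_cumI t).add (S.integrableY t)).const_mul L
    · refine Filter.Eventually.of_forall fun ω => ?_
      have P := S.path hθ ω
      obtain ⟨ε, hε, hm⟩ := P.mesh ht.le
      have hdiv : Filter.Tendsto (fun k : ℕ => t / k) Filter.atTop (nhds 0) := tendsto_const_div_atTop_nhds_zero_nat t
      refine squeeze_zero' (g := fun k : ℕ => L * (S.Y t ω * (t / k) * (S.cumI t ω + S.Y t ω)))
        (Filter.Eventually.of_forall fun k => Finset.sum_nonneg fun i _ => abs_nonneg _) ?_ ?_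
      · filter_upwards [Filter.eventually_gt_atTop 0, hdiv.eventually_lt_const hε] with k hk hkε
        have hstep : ∀ i ∈ Finset.range k, |S.stepErr f f' (p k i) (p k (i+1)) ω| ≤
            L * (S.Y t ω * (t / k)) * ((S.cumI (p k (i+1)) ω - S.cumI (p k i) ω) + ((S.Y (p k (i+1)) ω : ℝ) - S.Y (p k i) ω)) := by
          intro i hi
          have hik := Finset.mem_range.1 hi
          have h1 := (key k i hik ω).2 (hm _ _ (hp0 k i) (hpm k i) (hpt k i hik) (by rw [hpd]; exact hkε))
          refine h1.trans ?_
          have h2 := P.dI_upper (hp0 k i) (hpm k i)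
          have h3 := P.dI_nonneg (hp0 k i) (hpm k i)
          have h4 : (S.Y (p k i) ω : ℝ) ≤ S.Y (p k (i+1)) ω := by exact_mod_cast S.mono ω (hp0 k i) (hp0 k (i+1)) (hpm k i)
          have h5 : (S.Y (p k (i+1)) ω : ℝ) ≤ S.Y t ω := by exact_mod_cast S.mono ω (hp0 k (i+1)) ht.le (hpt k i hik)
          rw [hpd] at h2
          have h6 : S.cumI (p k (i+1)) ω - S.cumI (p k i) ω ≤ S.Y t ω * (t / k) := h2.trans (by gcongr)
          have h7 : 0 ≤ (S.cumI (p k (i+1)) ω - S.cumI (p k i) ω) + ((S.Y (p k (i+1)) ω : ℝ) - S.Y (p k i) ω) := by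
            have : 0 ≤ S.cumI (p k (i+1)) ω - S.cumI (p k i) ω := h3
            linarith
          exact le_of_le_of_eq (mul_le_mul_of_nonneg_left (mul_le_mul_of_nonneg_right h6 h7) hL0) (by ring)
        refine (Finset.sum_le_sum hstep).trans ?_
        rw [← Finset.mul_sum, mul_assoc L]
        gcongr
        exact tele k ω hk
      · have := ((hdiv.const_mul (S.Y t ω : ℝ)).mul_const (S.cumI t ω + S.Y t ω)).const_mul L
        simpa using this
  rw [integral_zero] at hlim
  refine squeeze_zero (fun k => Finset.sum_nonneg fun i _ => abs_nonneg _) (fun k => ?_) hlim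
  rw [integral_finsetSum _ fun i _ => (S.int_stepErr hθ G (hp0 k i) (hpm k i)).1.abs]
  refine Finset.sum_le_sum fun i _ => ?_
  have := (S.int_stepErr hθ G (hp0 k i) (hpm k i)).2
  simp only [hp] at this ⊢
  rw [← this]
  exact abs_integral_le_integral_abs

end
end YuleSimonSetup

theorem num_key (θ ρ' a : ℝ) (hθ : 1 < θ) (hρ : 0 < ρ') (ha : Real.log θ - 1 + 1 / θ < a) :
    ∃ p : ℕ, 2 ≤ p ∧ ∀ x : ℝ, 0 ≤ x →
      x ^ p + (θ * p + ρ') * x ^ (p - 1) ≤ Real.exp a * (x + 1) ^ p := by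
  have hlim : Filter.Tendsto (fun m : ℕ => θ + (θ + ρ' - 1) / ((m : ℝ) + 1)) Filter.atTop (nhds θ) := by
    have h1 := tendsto_one_div_add_atTop_nhds_zero_nat (𝕜 := ℝ)
    have h2 := (h1.const_mul (θ + ρ' - 1)).const_add θ
    simpa [div_eq_mul_inv] using h2
  have hcont : Filter.Tendsto (fun r : ℝ => Real.log r - 1 + 1 / r) (nhds θ) (nhds (Real.log θ - 1 + 1 / θ)) := by
    have : ContinuousAt (fun r : ℝ => Real.log r - 1 + 1 / r) θ := by
      have : θ ≠ 0 := by linarith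
      fun_prop (disch := assumption)
    exact this
  obtain ⟨m, hm⟩ := ((hcont.comp hlim).eventually_lt_const ha).exists
  refine ⟨m + 2, by omega, fun x hx => ?_⟩
  set r : ℝ := θ + (θ + ρ' - 1) / ((m : ℝ) + 1) with hr
  have hr1 : 1 < r := by
    have : 0 < (θ + ρ' - 1) / ((m : ℝ) + 1) := by apply div_pos <;> [linarith; positivity]
    linarith
  simp only [Function.comp] at hm
  set q : ℝ := θ * ((m + 2 : ℕ) : ℝ) + ρ' with hq
  have hm0 : (0:ℝ) ≤ m := by positivity
  have hqr : q - 1 = r * (m + 1) := by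
    rw [hq, hr]; push_cast; field_simp; ring
  have hq1 : 0 < q - 1 := by rw [hqr]; positivity
  rcases hx.eq_or_lt with rfl | hx
  · simp; positivity
  set s : ℝ := r * (m + 2) / q with hs
  have hq0 : 0 < q := by linarith
  have hs0 : 0 < s := by positivity
  have hsinv : s⁻¹ = 1 - (1 - 1 / r) / (m + 2) := by
    rw [hs]
    have : q = r * (m + 1) + 1 := by linarith
    rw [this]; field_simp; ring
  have hsp : Real.exp (1 - 1 / r) ≤ s ^ (m + 2) := by
    have h1 : s⁻¹ ≤ Real.exp (-((1 - 1 / r) / (m + 2))) := by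
      rw [hsinv]
      have := Real.add_one_le_exp (-((1 - 1 / r) / ((m:ℝ) + 2)))
      linarith
    have h2 : (s⁻¹) ^ (m + 2) ≤ Real.exp (-(1 - 1 / r)) := by
      calc _ ≤ (Real.exp (-((1 - 1 / r) / (m + 2)))) ^ (m + 2) := by gcongr
        _ = _ := by
          rw [← Real.exp_nat_mul]; congr 1; push_cast; field_simp
    rw [inv_pow, Real.exp_neg] at h2
    exact (inv_le_inv₀ (by positivity) (Real.exp_pos _)).1 h2
  have hbig : r ≤ s ^ (m + 2) * Real.exp a := by
    have h1 : r * Real.exp (-(1 - 1 / r)) ≤ Real.exp a := by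
      have : r = Real.exp (Real.log r) := (Real.exp_log (by linarith)).symm
      calc _ = Real.exp (Real.log r - 1 + 1 / r) := by
            conv_lhs => rw [show r * Real.exp (-(1 - 1 / r)) = Real.exp (Real.log r) * Real.exp (-(1 - 1 / r)) by rw [← this]]
            rw [← Real.exp_add]; congr 1; ring
        _ ≤ _ := Real.exp_le_exp.2 hm.le
    calc r = Real.exp (1 - 1 / r) * (r * Real.exp (-(1 - 1 / r))) := by
            rw [mul_left_comm, ← Real.exp_add]; simp
      _ ≤ _ := by gcongr
  set v : ℝ := (x + 1) / x with hv
  have hv0 : 0 < v := by positivity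
  have hbern : 1 + ((m + 2 : ℕ) : ℝ) * (v / s - 1) ≤ (v / s) ^ (m + 2) := by
    have h3 : (-2:ℝ) ≤ v / s - 1 := by
      have : 0 < v / s := by positivity
      linarith
    have := one_add_mul_le_pow h3 (m + 2)
    simpa using this
  have hmain : 1 + q / x ≤ Real.exp a * v ^ (m + 2) := by
    calc 1 + q / x = r * (1 + ((m + 2 : ℕ) : ℝ) * (v / s - 1)) := by
          have e1 : r * ((m + 2) * (v / s)) = q * v := by
            rw [hs]; field_simp
          have e2 : q * v = q + q / x := by rw [hv]; field_simp
          push_cast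
          calc 1 + q / x = q * v - (q - 1) := by rw [e2]; ring
            _ = _ := by rw [← e1, hqr]; ring
      _ ≤ r * (v / s) ^ (m + 2) := by gcongr
      _ ≤ (s ^ (m + 2) * Real.exp a) * (v / s) ^ (m + 2) := by gcongr
      _ = Real.exp a * (s * (v / s)) ^ (m + 2) := by rw [mul_pow]; ring
      _ = _ := by rw [mul_div_cancel₀ _ hs0.ne']
  have : x ^ (m + 2) * (1 + q / x) ≤ x ^ (m + 2) * (Real.exp a * v ^ (m + 2)) := by gcongr
  calc _ = x ^ (m + 2) * (1 + q / x) := by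
        rw [show m + 2 - 1 = m + 1 by omega, pow_succ x (m + 1)]; field_simp
    _ ≤ _ := this
    _ = _ := by rw [hv, div_pow]; field_simp

theorem c2_bounds {ψ : ℝ → ℝ} (hψ : ContDiff ℝ 2 ψ) (M : ℝ) :
    ∃ K : ℝ, 0 ≤ K ∧ ∀ x ∈ Set.Icc 0 M, |ψ x| ≤ K ∧ |deriv ψ x| ≤ K ∧ ∀ x' ∈ Set.Icc 0 M,
      |ψ x' - ψ x| ≤ K * |x' - x| ∧ |ψ x' - ψ x - deriv ψ x * (x' - x)| ≤ K * (x' - x) ^ 2 := by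
  have hd : Differentiable ℝ ψ := hψ.differentiable (by norm_num)
  have hd1 : ContDiff ℝ 1 (deriv ψ) := by
    have : ContDiff ℝ (1 + 1) ψ := by norm_num; exact hψ
    exact (contDiff_succ_iff_deriv.1 this).2.2
  have hdd : Differentiable ℝ (deriv ψ) := hd1.differentiable (by norm_num)
  have hc2 : Continuous (deriv (deriv ψ)) := hd1.continuous_deriv (by norm_num)
  obtain ⟨K0, h0⟩ := isCompact_Icc.exists_bound_of_continuousOn (s := Set.Icc 0 M) hψ.continuous.continuousOn
  obtain ⟨K1, h1⟩ := isCompact_Icc.exists_bound_of_continuousOn (s := Set.Icc 0 M) hd1.continuous.continuousOn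
  obtain ⟨K2, h2⟩ := isCompact_Icc.exists_bound_of_continuousOn (s := Set.Icc 0 M) hc2.continuousOn
  set K := max 0 (max K0 (max K1 K2)) with hK
  have k0 : K0 ≤ K := by simp [hK]
  have k1 : K1 ≤ K := by simp [hK]
  have k2 : K2 ≤ K := by simp [hK]
  have kk : 0 ≤ K := by simp [hK]
  refine ⟨K, kk, fun x hx => ⟨(h0 x hx).trans k0, (h1 x hx).trans k1, fun x' hx' => ⟨?_, ?_⟩⟩⟩
  · exact (convex_Icc 0 M).norm_image_sub_le_of_norm_deriv_le (fun z _ => hd z)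
      (fun z hz => (h1 z hz).trans k1) hx hx'
  · have hsub : Set.uIcc x x' ⊆ Set.Icc 0 M := Set.uIcc_subset_Icc hx hx'
    have hg : ∀ z ∈ Set.uIcc x x', HasDerivWithinAt (fun z => ψ z - deriv ψ x * z) (deriv ψ z - deriv ψ x) (Set.uIcc x x') z := by
      intro z _
      have := (hd z).hasDerivAt.sub ((hasDerivAt_id z).const_mul (deriv ψ x))
      exact this.hasDerivWithinAt.congr_deriv (by simp)
    have := (convex_uIcc x x').norm_image_sub_le_of_norm_hasDerivWithin_le (C := K * |x' - x|) hg (fun z hz => by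
      have h3 := (convex_Icc 0 M).norm_image_sub_le_of_norm_deriv_le (f := deriv ψ) (fun z _ => hdd z)
        (fun z hz => (h2 z hz).trans k2) hx (hsub hz)
      refine h3.trans ?_
      gcongr
      exact Set.abs_sub_left_of_mem_uIcc hz) Set.left_mem_uIcc Set.right_mem_uIcc
    simp only [Real.norm_eq_abs] at this
    calc _ = |ψ x' - deriv ψ x * x' - (ψ x - deriv ψ x * x)| := by congr 1; ring
      _ ≤ _ := this
      _ = K * |x' - x| ^ 2 := by ring
      _ = _ := by rw [sq_abs]

theorem good_trunc (φ : ℕ → ℝ → ℝ) (hφ : ∀ y, ContDiff ℝ 2 (φ y)) (n : ℕ) (C : ℝ) :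
    ∃ K, GoodTest (fun y x => if y ≤ n then φ y x else C) (fun y x => if y ≤ n then deriv (φ y) x else 0) K := by
  choose k hk0 hk using fun y : ℕ => c2_bounds (hφ y) (y : ℝ)
  set K := ∑ y ∈ Finset.range (n + 1), k y + |C| with hK
  have hs : 0 ≤ ∑ y ∈ Finset.range (n + 1), k y := Finset.sum_nonneg fun y _ => hk0 y
  have hK0 : 0 ≤ K := by positivity
  have hkK : ∀ y, y ≤ n → k y ≤ K := fun y hy => by
    have := Finset.single_le_sum (f := k) (fun y _ => hk0 y) (Finset.mem_range.2 (Nat.lt_succ_of_le hy))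
    have := abs_nonneg C
    linarith
  have hCK : |C| ≤ K := by linarith
  refine ⟨K, hK0, fun y => ?_, fun y => ?_, fun y x h1 h2 => ?_, fun y x h1 h2 => ?_, fun y x x' h1 h2 h3 h4 => ?_, fun y x x' h1 h2 h3 h4 => ?_⟩
  · by_cases hy : y ≤ n <;> simp only [hy, if_true, if_false]
    · exact (hφ y).continuous.measurable
    · exact measurable_const
  · by_cases hy : y ≤ n <;> simp only [hy, if_true, if_false]
    · exact measurable_deriv _
    · exact measurable_const
  · by_cases hy : y ≤ n <;> simp only [hy, if_true, if_false]
    · exact (hk y x ⟨h1, h2⟩).1.trans (hkK y hy)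
    · exact hCK
  · by_cases hy : y ≤ n <;> simp only [hy, if_true, if_false]
    · exact (hk y x ⟨h1, h2⟩).2.1.trans (hkK y hy)
    · simpa using hK0
  · by_cases hy : y ≤ n <;> simp only [hy, if_true, if_false]
    · exact ((hk y x ⟨h1, h2⟩).2.2 x' ⟨h3, h4⟩).1.trans (by gcongr; exact hkK y hy)
    · simp; positivity
  · by_cases hy : y ≤ n <;> simp only [hy, if_true, if_false]
    · exact ((hk y x ⟨h1, h2⟩).2.2 x' ⟨h3, h4⟩).2.trans (by gcongr; exact hkK y hy)
    · simp; positivity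


namespace YuleSimonSetup
variable {θ ρ : ℝ} (S : YuleSimonSetup θ ρ)

theorem measSet (n : ℕ) (t : ℝ) : MeasurableSet {ω | n < S.Y t ω} :=
  measurableSet_lt measurable_const (S.measYt t)

theorem u_zero (f : ℕ → ℝ → ℝ) (hθ : 0 < θ) : ∫ ω, f (S.Y 0 ω) (S.F 0 ω) ∂S.P = f 1 1 := by
  have : (fun ω => f (S.Y 0 ω) (S.F 0 ω)) = fun _ => f 1 1 := by
    ext ω
    have h1 : S.F 0 ω = 1 := (S.path hθ ω).F0
    rw [h1, S.Y0]
  rw [this]; simp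

theorem super_le {f f' : ℕ → ℝ → ℝ} {K : ℝ} (hθ : 0 < θ) (G : GoodTest f f' K)
    (hg : ∀ (y : ℕ) (x : ℝ), 0 ≤ x → x ≤ y → gen θ f f' y x ≤ 0) {t : ℝ} (ht : 0 < t) :
    ∫ ω, f (S.Y t ω) (S.F t ω) ∂S.P ≤ f 1 1 := by
  rw [← sub_nonpos]
  refine ge_of_tendsto (S.core hθ G ht) ?_
  filter_upwards [Filter.eventually_gt_atTop 0] with k hk
  set u : ℝ → ℝ := fun s => ∫ ω, f (S.Y s ω) (S.F s ω) ∂S.P with hu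
  have hk' : (k:ℝ) ≠ 0 := by exact_mod_cast hk.ne'
  have e := Finset.sum_range_sub (fun i : ℕ => u (t * i / k)) k
  rw [show t * (k:ℝ) / k = t by field_simp] at e
  have e0 : u (t * ((0:ℕ):ℝ) / k) = f 1 1 := by
    have := S.u_zero f hθ
    simpa [hu] using this
  rw [e0] at e
  change u t - f 1 1 ≤ _
  rw [← e]
  refine Finset.sum_le_sum fun i _ => ?_
  have hs : 0 ≤ t * (i:ℝ) / k := by positivity
  have hst : t * (i:ℝ) / k ≤ t * ((i + 1 : ℕ) : ℝ) / k := by gcongr; simp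
  have hneg : ∫ ω, gen θ f f' (S.Y (t * i / k) ω) (S.F (t * i / k) ω) *
          (S.cumI (t * (i + 1 : ℕ) / k) ω - S.cumI (t * i / k) ω) ∂S.P ≤ 0 := by
    refine integral_nonpos fun ω => ?_
    have b := (S.path hθ ω).F_bounds hs
    exact mul_nonpos_of_nonpos_of_nonneg (hg _ _ b.1 b.2) ((S.path hθ ω).dI_nonneg hs hst)
  refine le_trans ?_ (le_abs_self _)
  linarith

theorem T_nonpos : S.P {ω | S.T ω ≤ 0} = 0 := by
  rw [S.lawT 0 le_rfl]; simp

theorem tail_le (n : ℕ) (b : ℝ) (hb : 0 ≤ b) (h : ∀ t > 0, S.P.real {ω | n < S.Y t ω} ≤ b) :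
    (S.tail n).toReal ≤ b := by
  have hsub : {ω | n < S.Y (S.T ω) ω} ⊆ {ω | S.T ω ≤ 0} ∪ ⋃ j : ℕ, {ω | n < S.Y ((j:ℝ) + 1) ω} := by
    intro ω hω
    by_cases hT : S.T ω ≤ 0
    · exact Or.inl hT
    · right
      obtain ⟨j, hj⟩ := exists_nat_ge (S.T ω)
      rw [Set.mem_iUnion]
      refine ⟨j, show n < S.Y ((j:ℝ) + 1) ω from lt_of_lt_of_le (show n < S.Y (S.T ω) ω from hω) ?_⟩
      exact S.mono ω (le_of_lt (not_le.1 hT)) (show (0:ℝ) ≤ (j:ℝ) + 1 by positivity) (by linarith)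
  have hmono : Monotone fun j : ℕ => {ω | n < S.Y ((j:ℝ) + 1) ω} := by
    intro i j hij ω hω
    refine lt_of_lt_of_le hω (S.mono ω (show (0:ℝ) ≤ (i:ℝ) + 1 by positivity) (show (0:ℝ) ≤ (j:ℝ) + 1 by positivity) ?_)
    have : (i:ℝ) ≤ j := by exact_mod_cast hij
    linarith
  have h1 : S.tail n ≤ ENNReal.ofReal b := by
    refine (measure_mono hsub).trans ((measure_union_le _ _).trans ?_)
    rw [S.T_nonpos, zero_add, hmono.measure_iUnion]
    refine iSup_le fun j => ?_
    rw [← ENNReal.ofReal_toReal (measure_ne_top S.P {ω | n < S.Y ((j:ℝ) + 1) ω})]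
    exact ENNReal.ofReal_le_ofReal (h _ (by positivity))
  exact ENNReal.toReal_le_of_le_ofReal hb h1

theorem upper (hθ : 1 < θ) (n : ℕ) (hn : 1 ≤ n) :
    (S.tail n).toReal ≤ θ * Real.exp (-((Real.log θ - 1 + 1 / θ) * (n + 1))) := by
  have hθ0 : 0 < θ := by linarith
  set c := Real.log θ - 1 + 1 / θ with hc
  set b := 1 - 1 / θ with hb
  have hb0 : 0 ≤ b := by
    have : 1 / θ ≤ 1 := by rw [div_le_one hθ0]; linarith
    linarith
  have hcb : Real.exp (c + b) = θ := by
    rw [show c + b = Real.log θ by rw [hc, hb]; ring, Real.exp_log hθ0]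
  set φ : ℕ → ℝ → ℝ := fun y x => Real.exp (c * y + b * x) with hφ
  set C := Real.exp (c * (n + 1)) with hC
  obtain ⟨K, G⟩ := good_trunc φ (fun y => by simp only [hφ]; fun_prop) n C
  have hderiv : ∀ y x, deriv (φ y) x = b * Real.exp (c * y + b * x) := by
    intro y x
    have : HasDerivAt (φ y) (Real.exp (c * y + b * x) * (b * 1)) x :=
      ((hasDerivAt_id x).const_mul b |>.const_add (c * y)).exp
    rw [this.deriv]; ring
  have hgen : ∀ (y : ℕ) (x : ℝ), 0 ≤ x → x ≤ y → gen θ (fun y x => if y ≤ n then φ y x else C)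
      (fun y x => if y ≤ n then deriv (φ y) x else 0) y x ≤ 0 := by
    intro y x hx hxy
    have hid : Real.exp (c * ((y + 1 : ℕ):ℝ) + b * (x + 1)) - Real.exp (c * y + b * x) - θ * (b * Real.exp (c * y + b * x)) = 0 := by
      have : Real.exp (c * ((y + 1 : ℕ):ℝ) + b * (x + 1)) = θ * Real.exp (c * y + b * x) := by
        rw [← hcb, ← Real.exp_add]; congr 1; push_cast; ring
      rw [this]
      have : θ * b = θ - 1 := by rw [hb]; field_simp
      linear_combination (-Real.exp (c * y + b * x)) * this
    simp only [gen]
    by_cases h1 : y + 1 ≤ n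
    · have h2 : y ≤ n := by omega
      simp only [h1, h2, if_true, hderiv]
      simp only [hφ]
      exact hid.le
    · by_cases h2 : y ≤ n
      · have hy : y = n := by omega
        simp only [h1, h2, if_true, if_false, hderiv]
        simp only [hφ]
        have : C ≤ Real.exp (c * ((y + 1 : ℕ):ℝ) + b * (x + 1)) := by
          rw [hC, hy]; push_cast
          apply Real.exp_le_exp.2
          have : 0 ≤ b * (x + 1) := by positivity
          linarith
        linarith
      · simp [h1, h2]
  refine S.tail_le n _ (by positivity) fun t ht => ?_
  have h1 := S.super_le hθ0 G hgen ht
  simp only [hn, if_true] at h1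
  have h11 : φ 1 1 = θ := by simp only [hφ]; rw [← hcb]; congr 1; push_cast; ring
  rw [h11] at h1
  have h2 : C * S.P.real {ω | n < S.Y t ω} ≤ θ := by
    refine le_trans ?_ h1
    rw [← integral_indicator_one (S.measSet n t), ← integral_const_mul]
    refine integral_mono ?_ (S.int_f hθ0 G ht.le) fun ω => ?_
    · exact ((integrable_indicator_iff (S.measSet n t)).2 (integrable_const (1:ℝ)).integrableOn).const_mul C
    · by_cases hω : n < S.Y t ω
      · simp [Set.indicator, hω, not_le.2 hω]
      · simp only [Set.indicator, Set.mem_ofPred_eq, hω, if_false, mul_zero, not_lt.1 hω, if_true, hφ]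
        positivity
  rw [Real.exp_neg, ← div_eq_mul_inv, le_div_iff₀ (Real.exp_pos _)]
  linarith

theorem lawT_Ioc {s t : ℝ} (hs : 0 ≤ s) (hst : s ≤ t) (hρ : 0 < ρ) :
    S.P.real (S.T ⁻¹' Set.Ioc s t) = Real.exp (-ρ * s) - Real.exp (-ρ * t) := by
  have hreal : ∀ r, 0 ≤ r → S.P.real {ω | S.T ω ≤ r} = 1 - Real.exp (-ρ * r) := by
    intro r hr
    rw [Measure.real, S.lawT r hr, ENNReal.toReal_ofReal]
    have : Real.exp (-ρ * r) ≤ 1 := Real.exp_le_one_iff.2 (by nlinarith)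
    linarith
  have hset : S.T ⁻¹' Set.Ioc s t = {ω | S.T ω ≤ t} \ {ω | S.T ω ≤ s} := by
    ext ω; simp [and_comm]
  have hsubset : {ω | S.T ω ≤ s} ⊆ {ω | S.T ω ≤ t} := fun ω hω => le_trans (show S.T ω ≤ s from hω) hst
  rw [hset, measureReal_sdiff hsubset (measurableSet_le S.measT measurable_const),
    hreal s hs, hreal t (hs.trans hst)]
  ring

theorem tail_ge (hρ : 0 < ρ) (n : ℕ) (p : ℕ → ℝ) (hp : Monotone p) (hp0 : ∀ i, 0 ≤ p i) (k : ℕ) :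
    ∑ i ∈ Finset.range k, (Real.exp (-ρ * p i) - Real.exp (-ρ * p (i + 1))) * S.P.real {ω | n < S.Y (p i) ω}
      ≤ (S.tail n).toReal := by
  have hind : ∀ i, (Real.exp (-ρ * p i) - Real.exp (-ρ * p (i + 1))) * S.P.real {ω | n < S.Y (p i) ω}
      = S.P.real (S.T ⁻¹' Set.Ioc (p i) (p (i+1)) ∩ {ω | n < S.Y (p i) ω}) := by
    intro i
    rw [← S.lawT_Ioc (hp0 i) (hp (Nat.le_succ i)) hρ]
    have hm : MeasurableSet {g : ℝ → ℕ | n < g (p i)} :=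
      measurableSet_lt measurable_const (measurable_pi_apply _)
    have := S.indepT.measure_inter_preimage_eq_mul (Set.Ioc (p i) (p (i+1))) {g : ℝ → ℕ | n < g (p i)} measurableSet_Ioc hm
    simp only [Measure.real]
    rw [← ENNReal.toReal_mul]
    exact congrArg ENNReal.toReal this.symm
  simp only [hind]
  rw [← measureReal_biUnion_finset]
  · refine measureReal_mono ?_ (measure_ne_top _ _)
    intro ω hω
    simp only [Set.mem_iUnion] at hω
    obtain ⟨i, _, hT, hY⟩ := hω
    exact lt_of_lt_of_le hY (S.mono ω (hp0 i) ((hp0 i).trans hT.1.le) hT.1.le)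
  · intro i _ j _ hij
    have := hp.pairwise_disjoint_on_Ioc_succ hij
    exact (this.preimage S.T).mono Set.inter_subset_left Set.inter_subset_left
  · intro i _
    exact (S.measT measurableSet_Ioc).inter (S.measSet n _)

theorem small_h {θ ρ : ℝ} (hθ : 0 < θ) (hρ : 0 < ρ) {h : ℝ} (h0 : 0 ≤ h) (h1 : (2 * θ + ρ) * h ≤ 1) :
    Real.exp (ρ * h) - 1 ≤ 2 * ρ * ((1 - Real.exp (-(θ * h))) / θ) := by
  have a1 : 0 ≤ θ * h := by positivity
  have a2 : 0 ≤ ρ * h := by positivity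
  have b1 := abs_le.1 (Real.abs_exp_sub_one_sub_id_le (x := ρ * h) (by rw [abs_of_nonneg a2]; nlinarith))
  have b2 := abs_le.1 (Real.abs_exp_sub_one_sub_id_le (x := -(θ * h)) (by rw [abs_neg, abs_of_nonneg a1]; nlinarith))
  have c1 : h * (1 - θ * h) ≤ (1 - Real.exp (-(θ * h))) / θ := by
    rw [le_div_iff₀ hθ]; nlinarith [b2.2]
  have c2 : 2 * ρ * (h * (1 - θ * h)) ≤ 2 * ρ * ((1 - Real.exp (-(θ * h))) / θ) := by gcongr
  have c3 : 0 ≤ (ρ * h) * (1 - (2 * θ + ρ) * h) := mul_nonneg a2 (by linarith)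
  nlinarith [b1.2]

theorem lower_gen {f f' : ℕ → ℝ → ℝ} {K C : ℝ} (hθ : 0 < θ) (hρ : 0 < ρ) (G : GoodTest f f' K) (n : ℕ)
    (hC : 0 ≤ C)
    (hf0 : ∀ (y : ℕ) (x : ℝ), 0 ≤ x → x ≤ y → 0 ≤ f y x)
    (hfC : ∀ (y : ℕ) (x : ℝ), 0 ≤ x → x ≤ y → f y x ≤ C)
    (hhi : ∀ (y : ℕ) (x : ℝ), n < y → f y x = C ∧ gen θ f f' y x = 0)
    (hlo : ∀ (y : ℕ) (x : ℝ), 0 ≤ x → x ≤ y → y ≤ n → 0 ≤ gen θ f f' y x ∧ 2 * ρ * f y x ≤ x * gen θ f f' y x) :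
    f 1 1 ≤ 2 * C * (S.tail n).toReal := by
  set u : ℝ → ℝ := fun s => ∫ ω, f (S.Y s ω) (S.F s ω) ∂S.P with hu
  have hu0 : ∀ s, 0 ≤ s → 0 ≤ u s := fun s hs => integral_nonneg fun ω => by
    have b := (S.path hθ ω).F_bounds hs
    exact hf0 _ _ b.1 b.2
  have huC : ∀ s, 0 ≤ s → u s ≤ C := fun s hs => by
    have := integral_mono (S.int_f hθ G hs) (integrable_const C) (μ := S.P) fun ω => by
      have b := (S.path hθ ω).F_bounds hs
      exact hfC _ _ b.1 b.2
    simpa using this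
  -- finite-horizon bound
  have fin : ∀ t : ℝ, 0 < t → f 1 1 - Real.exp (-ρ * t) * C - 2 * C * (S.tail n).toReal ≤ 0 := by
    intro t ht
    refine ge_of_tendsto (S.core hθ G ht) ?_
    have hdiv : Filter.Tendsto (fun k : ℕ => (2 * θ + ρ) * (t / k)) Filter.atTop (nhds 0) := by
      simpa using (tendsto_const_div_atTop_nhds_zero_nat t).const_mul (2 * θ + ρ)
    filter_upwards [Filter.eventually_gt_atTop 0, hdiv.eventually_le_const one_pos] with k hk hkh
    have hk' : (0:ℝ) < k := by exact_mod_cast hk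
    set h : ℝ := t / k with hh
    have h0 : 0 ≤ h := by positivity
    set p : ℕ → ℝ := fun i => t * i / k with hp
    have hp0 : ∀ i, 0 ≤ p i := fun i => by simp only [hp]; positivity
    have hpm : Monotone p := fun i j hij => by simp only [hp]; gcongr
    have hpd : ∀ i, p (i + 1) = p i + h := fun i => by simp only [hp, hh]; push_cast; ring
    set W : ℕ → ℝ := fun i => Real.exp (-ρ * p i) with hW
    set v : ℕ → ℝ := fun i => S.P.real {ω | n < S.Y (p i) ω} with hv
    have hv0 : ∀ i, 0 ≤ v i := fun i => measureReal_nonneg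
    set η := (1 - Real.exp (-(θ * h))) / θ with hη
    have hηh : η ≤ h := by
      rw [hη, div_le_iff₀ hθ]
      have := Real.add_one_le_exp (-(θ * h))
      linarith
    have hη0 : 0 ≤ η := by
      refine div_nonneg ?_ hθ.le
      have : Real.exp (-(θ * h)) ≤ 1 := Real.exp_le_one_iff.2 (by nlinarith)
      linarith
    have hsm := small_h hθ hρ h0 hkh
    rw [← hη] at hsm
    have hWW : ∀ i, W i = W (i + 1) * Real.exp (ρ * h) := fun i => by
      simp only [hW]; rw [hpd, ← Real.exp_add]; congr 1; ring
    have hgenE : ∀ i, 2 * ρ * η * (u (p i) - C * v i) ≤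
        ∫ ω, gen θ f f' (S.Y (p i) ω) (S.F (p i) ω) * (S.cumI (p (i+1)) ω - S.cumI (p i) ω) ∂S.P := by
      intro i
      have hI1 := S.int_f hθ G (hp0 i)
      have hI2 : Integrable (fun ω => C * ({ω | n < S.Y (p i) ω}.indicator 1 ω : ℝ)) S.P :=
        ((integrable_indicator_iff (S.measSet n (p i))).2 (integrable_const (1:ℝ)).integrableOn).const_mul C
      simp only [hu, hv]
      rw [← integral_indicator_one (S.measSet n (p i)), ← integral_const_mul C, ← integral_sub hI1 hI2, ← integral_const_mul]
      refine integral_mono ((hI1.sub hI2).const_mul _) (S.int_gen hθ G (hp0 i)) fun ω => ?_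
      have P := S.path hθ ω
      have b := P.F_bounds (hp0 i)
      by_cases hω : n < S.Y (p i) ω
      · have := hhi (S.Y (p i) ω) (S.F (p i) ω) hω
        simp [Set.indicator, hω, this.1, this.2]
      · have h1 := hlo _ _ b.1 b.2 (not_lt.1 hω)
        have h2 := P.dI_lower (hp0 i) (hpm (Nat.le_succ i))
        rw [show p i.succ - p i = h by rw [Nat.succ_eq_add_one, hpd]; ring, ← hη] at h2
        simp only [Set.indicator, Set.mem_ofPred_eq, hω, if_false, mul_zero, sub_zero]
        calc 2 * ρ * η * f (S.Y (p i) ω) (S.F (p i) ω) = (2 * ρ * f (S.Y (p i) ω) (S.F (p i) ω)) * η := by ring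
          _ ≤ (S.F (p i) ω * gen θ f f' (S.Y (p i) ω) (S.F (p i) ω)) * η := mul_le_mul_of_nonneg_right h1.2 hη0
          _ = gen θ f f' (S.Y (p i) ω) (S.F (p i) ω) * (S.F (p i) ω * η) := by ring
          _ ≤ _ := mul_le_mul_of_nonneg_left h2 h1.1
    have hstep : ∀ i ∈ Finset.range k, -(W (i+1) * u (p (i+1)) - W i * u (p i)) - 2 * C * ((W i - W (i+1)) * v i) ≤
        |u (p (i+1)) - u (p i) - ∫ ω, gen θ f f' (S.Y (p i) ω) (S.F (p i) ω) * (S.cumI (p (i+1)) ω - S.cumI (p i) ω) ∂S.P| := by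
      intro i _
      set d := |u (p (i+1)) - u (p i) - ∫ ω, gen θ f f' (S.Y (p i) ω) (S.F (p i) ω) * (S.cumI (p (i+1)) ω - S.cumI (p i) ω) ∂S.P| with hd
      have d0 : 0 ≤ d := abs_nonneg _
      have d1 := neg_abs_le (u (p (i+1)) - u (p i) - ∫ ω, gen θ f f' (S.Y (p i) ω) (S.F (p i) ω) * (S.cumI (p (i+1)) ω - S.cumI (p i) ω) ∂S.P)
      rw [← hd] at d1
      have d2 := hgenE i
      have W0 : 0 < W (i+1) := Real.exp_pos _
      have W1 : W (i+1) ≤ 1 := Real.exp_le_one_iff.2 (by nlinarith [hp0 (i+1)])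
      have k1 : W (i+1) * (u (p (i+1)) - u (p i)) ≥ W (i+1) * (2 * ρ * η * (u (p i) - C * v i) - d) :=
        mul_le_mul_of_nonneg_left (by linarith) W0.le
      have k2 : W (i+1) * d ≤ d := by nlinarith
      have k3 : (W i - W (i+1)) * u (p i) ≤ W (i+1) * (2 * ρ * η) * u (p i) := by
        refine mul_le_mul_of_nonneg_right ?_ (hu0 _ (hp0 i))
        rw [hWW i]
        nlinarith
      have k4 : W (i+1) * (ρ * η) ≤ W i - W (i+1) := by
        rw [hWW i]
        have := Real.add_one_le_exp (ρ * h)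
        have : ρ * η ≤ ρ * h := by gcongr
        nlinarith
      have k5 : W (i+1) * (ρ * η) * (C * v i) ≤ (W i - W (i+1)) * (C * v i) :=
        mul_le_mul_of_nonneg_right k4 (mul_nonneg hC (hv0 i))
      nlinarith
    have hsum := Finset.sum_le_sum hstep
    rw [Finset.sum_sub_distrib, Finset.sum_neg_distrib, Finset.sum_range_sub (fun i => W i * u (p i)), ← Finset.mul_sum] at hsum
    have e1 : p k = t := by simp only [hp]; field_simp
    have e0 : p 0 = 0 := by simp [hp]
    have hW0 : W 0 = 1 := by simp [hW, e0]
    have hWk : W k = Real.exp (-ρ * t) := by simp only [hW, e1]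
    have hu1 : u (p 0) = f 1 1 := by rw [e0]; exact S.u_zero f hθ
    rw [hW0, hu1, hWk, e1, one_mul] at hsum
    have hT := S.tail_ge hρ n p hpm hp0 k
    have t1 : Real.exp (-ρ * t) * u t ≤ Real.exp (-ρ * t) * C := by
      gcongr; exact huC t ht.le
    have t2 : 2 * C * ∑ i ∈ Finset.range k, ((W i - W (i+1)) * v i) ≤ 2 * C * (S.tail n).toReal := by
      gcongr
    refine le_trans ?_ hsum
    linarith
  have hlim : Filter.Tendsto (fun t : ℝ => f 1 1 - Real.exp (-ρ * t) * C - 2 * C * (S.tail n).toReal) Filter.atTop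
      (nhds (f 1 1 - 0 * C - 2 * C * (S.tail n).toReal)) := by
    have : Filter.Tendsto (fun t : ℝ => Real.exp (-ρ * t)) Filter.atTop (nhds 0) := by
      refine Real.tendsto_exp_atBot.comp ?_
      exact Filter.tendsto_id.const_mul_atTop_of_neg (by linarith)
    exact ((this.mul_const C).const_sub (f 1 1)).sub_const _
  have := le_of_tendsto hlim (by filter_upwards [Filter.eventually_gt_atTop 0] with t ht using fin t ht)
  linarith

theorem lower (hθ : 1 < θ) (hρ : 0 < ρ) {a : ℝ} (ha : Real.log θ - 1 + 1 / θ < a) :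
    ∃ p : ℕ, ∀ n : ℕ, 1 ≤ n →
      Real.exp (-(a * n)) / (2 * ((n : ℝ) + 1) ^ p) ≤ (S.tail n).toReal := by
  obtain ⟨p, hp2, hp⟩ := num_key θ (2 * ρ) a hθ (by linarith) ha
  have hθ0 : 0 < θ := by linarith
  have ha0 : 0 ≤ a := by
    have h1 := Real.one_sub_inv_le_log_of_pos hθ0
    rw [one_div] at ha
    linarith
  refine ⟨p, fun n hn => ?_⟩
  set φ : ℕ → ℝ → ℝ := fun y x => Real.exp (a * y) * x ^ p with hφ
  set C := Real.exp (a * (n + 1)) * ((n : ℝ) + 1) ^ p with hC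
  have hC0 : 0 < C := by positivity
  obtain ⟨K, G⟩ := good_trunc φ (fun y => by simp only [hφ]; fun_prop) n C
  have hderiv : ∀ y x, deriv (φ y) x = Real.exp (a * y) * (p * x ^ (p - 1)) := by
    intro y x
    exact ((hasDerivAt_pow p x).const_mul (Real.exp (a * y))).deriv
  have main := S.lower_gen hθ0 hρ G n hC0.le ?_ ?_ ?_ ?_
  · simp only [hn, if_true] at main
    have h11 : φ 1 1 = Real.exp a := by simp [hφ]
    rw [h11, hC] at main
    rw [div_le_iff₀ (by positivity)]
    have e1 : Real.exp (a * (n + 1)) = Real.exp a * Real.exp (a * n) := by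
      rw [← Real.exp_add]; congr 1; ring
    rw [e1] at main
    have e2 : Real.exp a * 1 ≤ Real.exp a * (Real.exp (a * n) * ((S.tail n).toReal * (2 * ((n:ℝ) + 1) ^ p))) := by
      linarith
    have e3 := le_of_mul_le_mul_left e2 (Real.exp_pos a)
    rw [Real.exp_neg, inv_le_iff_one_le_mul₀' (Real.exp_pos _)]
    exact e3
  · intro y x hx _
    by_cases h : y ≤ n <;> simp only [h, if_true, if_false, hφ] <;> positivity
  · intro y x hx hxy
    by_cases h : y ≤ n <;> simp only [h, if_true, if_false, hφ]
    · have : (y:ℝ) ≤ n := by exact_mod_cast h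
      rw [hC]
      gcongr <;> linarith
    · exact le_rfl
  · intro y x hy
    have h1 : ¬ y ≤ n := by omega
    have h2 : ¬ y + 1 ≤ n := by omega
    simp [gen, h1, h2]
  · intro y x hx hxy hy
    have key := hp x hx
    have hE := Real.exp_pos (a * y)
    have hg : Real.exp (a * y) * (2 * ρ * x ^ (p - 1)) ≤ gen θ (fun y x => if y ≤ n then φ y x else C)
      (fun y x => if y ≤ n then deriv (φ y) x else 0) y x := by
      have base : Real.exp (a * y) * (2 * ρ * x ^ (p - 1)) ≤ Real.exp (a * y) * (Real.exp a * (x + 1) ^ p)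
          - Real.exp (a * y) * x ^ p - θ * (Real.exp (a * y) * (p * x ^ (p - 1))) := by
        have := mul_le_mul_of_nonneg_left key hE.le
        linarith
      have e1 : Real.exp (a * ((y + 1 : ℕ) : ℝ)) * (x + 1) ^ p = Real.exp (a * y) * (Real.exp a * (x + 1) ^ p) := by
        rw [← mul_assoc, ← Real.exp_add]; congr 2; push_cast; ring
      simp only [gen]
      by_cases h1 : y + 1 ≤ n
      · simp only [h1, hy, if_true, hderiv]
        simp only [hφ]
        rw [e1]; exact base
      · simp only [h1, hy, if_true, if_false, hderiv]
        simp only [hφ]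
        have : Real.exp (a * ((y + 1 : ℕ) : ℝ)) * (x + 1) ^ p ≤ C := by
          have hyn : (y:ℝ) ≤ n := by exact_mod_cast hy
          rw [hC]; push_cast
          gcongr
          linarith
        rw [e1] at this
        linarith
    constructor
    · exact le_trans (by positivity) hg
    · simp only [hy, if_true]
      refine le_trans (le_of_eq ?_) (mul_le_mul_of_nonneg_left hg hx)
      simp only [hφ]
      obtain ⟨q, rfl⟩ : ∃ q, p = q + 1 := ⟨p - 1, by omega⟩
      simp only [Nat.add_sub_cancel]
      ring

end YuleSimonSetup

open Filter in
/-- Supercritical exponential tail decay: if `θ > 1` and `ρ > 0`, then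
`ln P(X_{θ,ρ} > n) ∼ −(ln θ − 1 + 1/θ) n`, i.e.
`lim_{n→∞} n⁻¹ ln P(X_{θ,ρ} > n) = −(ln θ − 1 + 1/θ)`. -/
theorem yule_simon_exponential_tail (θ ρ : ℝ) (hθ : 1 < θ) (hρ : 0 < ρ)
    (S : YuleSimonSetup θ ρ) :
    Tendsto (fun n : ℕ => (n : ℝ)⁻¹ * Real.log (S.tail n).toReal) atTop
      (nhds (-(Real.log θ - 1 + 1/θ))) := by
  set c := Real.log θ - 1 + 1 / θ with hc
  have inv0 : Tendsto (fun n : ℕ => (n : ℝ)⁻¹) atTop (nhds 0) := tendsto_inv_atTop_nhds_zero_nat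
  have hlog : Tendsto (fun n : ℕ => Real.log ((n : ℝ) + 1) * (n : ℝ)⁻¹) atTop (nhds 0) := by
    have h1 := Real.tendsto_pow_log_div_mul_add_atTop 1 (-1) 1 one_ne_zero
    have h2 : Tendsto (fun n : ℕ => (n : ℝ) + 1) atTop atTop :=
      tendsto_atTop_add_const_right _ _ tendsto_natCast_atTop_atTop
    refine (h1.comp h2).congr fun n => ?_
    simp [div_eq_mul_inv]
  have hpos : ∀ n : ℕ, 1 ≤ n → 0 < (S.tail n).toReal := by
    intro n hn
    obtain ⟨p, hp⟩ := S.lower hθ hρ (a := c + 1) (by linarith)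
    exact lt_of_lt_of_le (by positivity) (hp n hn)
  rw [tendsto_order]
  constructor
  · intro l hl
    obtain ⟨a, ha1, ha2⟩ := exists_between (show c < -l by linarith)
    obtain ⟨p, hp⟩ := S.lower hθ hρ ha1
    have hlim : Tendsto (fun n : ℕ => -a - (n : ℝ)⁻¹ * Real.log 2 - p * (Real.log ((n : ℝ) + 1) * (n : ℝ)⁻¹))
        atTop (nhds (-a - 0 * Real.log 2 - p * 0)) :=
      ((inv0.mul_const _).const_sub (-a)).sub (hlog.const_mul _)
    filter_upwards [eventually_ge_atTop 1, hlim.eventually_const_lt (show l < -a - 0 * Real.log 2 - p * 0 by simp; linarith)] with n hn hl2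
    refine hl2.trans_le ?_
    have hn0 : (0:ℝ) < n := by exact_mod_cast hn
    have h1 := Real.log_le_log (by positivity) (hp n hn)
    rw [Real.log_div (Real.exp_pos _).ne' (by positivity), Real.log_exp,
      Real.log_mul two_ne_zero (by positivity), Real.log_pow] at h1
    calc _ = (n : ℝ)⁻¹ * (-(a * n) - (Real.log 2 + p * Real.log ((n : ℝ) + 1))) := by
          field_simp; ring
      _ ≤ _ := by gcongr
  · intro b hb
    have hlim : Tendsto (fun n : ℕ => (n : ℝ)⁻¹ * Real.log θ - c - (n : ℝ)⁻¹ * c)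
        atTop (nhds (0 * Real.log θ - c - 0 * c)) :=
      ((inv0.mul_const _).sub_const c).sub (inv0.mul_const _)
    filter_upwards [eventually_ge_atTop 1, hlim.eventually_lt_const (show 0 * Real.log θ - c - 0 * c < b by simp; linarith)] with n hn hl2
    refine lt_of_le_of_lt ?_ hl2
    have hn0 : (0:ℝ) < n := by exact_mod_cast hn
    have hθ0 : 0 < θ := by linarith
    have h1 := Real.log_le_log (hpos n hn) (S.upper hθ n hn)
    rw [← hc, Real.log_mul hθ0.ne' (Real.exp_pos _).ne', Real.log_exp] at h1
    calc _ ≤ (n : ℝ)⁻¹ * (Real.log θ + -(c * (n + 1))) := by gcongr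
      _ = _ := by field_simp; ring
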